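/- Cocoercivity of gradients of convex smooth functions: if h : ℝ^d → ℝ is convex and β-smooth (β > 0), then for all x, y ∈ ℝ^d, ‖∇h(x) − ∇h(y)‖² ≤ β ⟨∇h(x) − ∇h(y), x − y⟩. -/

import Mathlib

open scoped InnerProductSpace

theorem cc_line {E : Type*} [NormedAddCommGroup E] [InnerProductSpace ℝ E] [FiniteDimensional ℝ E]
    (h : E → ℝ) (hdiff : Differentiable ℝ h) (x v : E) (t : ℝ) :
    HasDerivAt (fun s : ℝ => h (x + s • v)) ⟪gradient h (x + t • v), v⟫_ℝ t := by
  have h1 := (hdiff (x + t • v)).hasFDerivAt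
  have h2 : HasDerivAt (fun s : ℝ => x + s • v) v t := by
    simpa using ((hasDerivAt_id t).smul_const v).const_add x
  have h3 : ⟪gradient h (x + t • v), v⟫_ℝ = fderiv ℝ h (x + t • v) v := by simp
  rw [h3]
  exact h1.comp_hasDerivAt t h2

theorem cc_descent {E : Type*} [NormedAddCommGroup E] [InnerProductSpace ℝ E]
    [FiniteDimensional ℝ E] (h : E → ℝ) (β : ℝ)
    (hdiff : Differentiable ℝ h)
    (hsmooth : ∀ x y : E, ‖gradient h x - gradient h y‖ ≤ β * ‖x - y‖) (x v : E) :
    h (x + v) ≤ h x + ⟪gradient h x, v⟫_ℝ + β / 2 * ‖v‖ ^ 2 := by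
  have hd : ∀ t : ℝ, HasDerivAt
      (fun s : ℝ => h (x + s • v) - s * ⟪gradient h x, v⟫_ℝ - s ^ 2 * (β / 2 * ‖v‖ ^ 2))
      (⟪gradient h (x + t • v), v⟫_ℝ - ⟪gradient h x, v⟫_ℝ - 2 * t * (β / 2 * ‖v‖ ^ 2)) t := by
    intro t
    have h1 := ((cc_line h hdiff x v t).sub
      ((hasDerivAt_id t).mul_const ⟪gradient h x, v⟫_ℝ)).sub
      ((hasDerivAt_pow 2 t).mul_const (β / 2 * ‖v‖ ^ 2))
    refine h1.congr_deriv ?_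
    simp
  have ha := antitoneOn_of_deriv_nonpos (convex_Icc (0:ℝ) 1)
    (fun t _ => (hd t).continuousAt.continuousWithinAt)
    (fun t _ => (hd t).differentiableAt.differentiableWithinAt)
    (by
      intro t ht
      rw [interior_Icc] at ht
      rw [(hd t).deriv, ← inner_sub_left]
      have h1 := real_inner_le_norm (gradient h (x + t • v) - gradient h x) v
      have h2 := hsmooth (x + t • v) x
      rw [add_sub_cancel_left, norm_smul, Real.norm_of_nonneg ht.1.le] at h2
      have h3 := mul_le_mul_of_nonneg_right h2 (norm_nonneg v)
      linarith)
  have h0 := ha (Set.left_mem_Icc.2 zero_le_one) (Set.right_mem_Icc.2 zero_le_one) zero_le_one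
  simp at h0
  have h9 : ⟪gradient h x, v⟫_ℝ = fderiv ℝ h x v := by simp
  linarith

theorem cc_convex {E : Type*} [NormedAddCommGroup E] [InnerProductSpace ℝ E]
    [FiniteDimensional ℝ E] (h : E → ℝ)
    (hdiff : Differentiable ℝ h) (hconv : ConvexOn ℝ Set.univ h) (x v : E) :
    h x + ⟪gradient h x, v⟫_ℝ ≤ h (x + v) := by
  have hc : ConvexOn ℝ Set.univ (fun s : ℝ => h (x + s • v)) := by
    refine ⟨convex_univ, fun s _ t _ a b ha hb hab => ?_⟩
    have := hconv.2 (Set.mem_univ (x + s • v)) (Set.mem_univ (x + t • v)) ha hb hab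
    convert this using 2
    have hx : x = (a + b) • x := by rw [hab, one_smul]
    nth_rewrite 1 [hx]
    simp only [smul_eq_mul]
    module
  have h1 := hc.le_slope_of_hasDerivAt (Set.mem_univ 0) (Set.mem_univ 1) zero_lt_one
    (cc_line h hdiff x v 0)
  simp [slope_def_field] at h1
  have h9 : ⟪gradient h x, v⟫_ℝ = fderiv ℝ h x v := by simp
  linarith

theorem cc_key {E : Type*} [NormedAddCommGroup E] [InnerProductSpace ℝ E]
    [FiniteDimensional ℝ E] (h : E → ℝ) (β : ℝ) (hβ : 0 < β)
    (hdiff : Differentiable ℝ h) (hconv : ConvexOn ℝ Set.univ h)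
    (hsmooth : ∀ x y : E, ‖gradient h x - gradient h y‖ ≤ β * ‖x - y‖) (x y : E) :
    h x + ⟪gradient h x, y - x⟫_ℝ + 1 / (2 * β) * ‖gradient h y - gradient h x‖ ^ 2 ≤ h y := by
  set d := gradient h y - gradient h x with hd
  have h1 := cc_descent h β hdiff hsmooth y (-(β⁻¹ • d))
  have h2 := cc_convex h hdiff hconv x (y - x + -(β⁻¹ • d))
  have e : x + (y - x + -(β⁻¹ • d)) = y + -(β⁻¹ • d) := by abel
  have h3 : ⟪gradient h y, d⟫_ℝ - ⟪gradient h x, d⟫_ℝ = ‖d‖ ^ 2 := by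
    rw [← inner_sub_left, ← hd, real_inner_self_eq_norm_sq]
  rw [e, inner_add_right, inner_neg_right, real_inner_smul_right] at h2
  rw [inner_neg_right, real_inner_smul_right, norm_neg, norm_smul, mul_pow,
    Real.norm_of_nonneg (inv_pos.2 hβ).le] at h1
  have h4 : β / 2 * (β⁻¹ ^ 2 * ‖d‖ ^ 2) = β⁻¹ * ‖d‖ ^ 2 - 1 / (2 * β) * ‖d‖ ^ 2 := by
    field_simp
    ring
  have h5 : β⁻¹ * ⟪gradient h y, d⟫_ℝ - β⁻¹ * ⟪gradient h x, d⟫_ℝ = β⁻¹ * ‖d‖ ^ 2 := by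
    rw [← h3]; ring
  linarith

/-- Cocoercivity of gradients of convex smooth functions: if `h` is convex and `β`-smooth
(`β > 0`), then for all `x, y`, `‖∇h(x) − ∇h(y)‖² ≤ β ⟨∇h(x) − ∇h(y), x − y⟩`. -/
theorem cocoercivity_of_convex_smooth
    {E : Type*} [NormedAddCommGroup E] [InnerProductSpace ℝ E] [FiniteDimensional ℝ E]
    (h : E → ℝ) (β : ℝ) (hβ : 0 < β)
    (hdiff : Differentiable ℝ h)
    (hconv : ConvexOn ℝ Set.univ h)
    (hsmooth : ∀ x y : E, ‖gradient h x - gradient h y‖ ≤ β * ‖x - y‖) :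
    ∀ x y : E,
      ‖gradient h x - gradient h y‖ ^ 2 ≤ β * ⟪gradient h x - gradient h y, x - y⟫_ℝ := by
  intro x y
  have h1 := cc_key h β hβ hdiff hconv hsmooth x y
  have h2 := cc_key h β hβ hdiff hconv hsmooth y x
  rw [norm_sub_rev] at h1
  rw [← neg_sub x y, inner_neg_right] at h1
  rw [inner_sub_left]
  have h3 : 1 / (2 * β) * ‖gradient h x - gradient h y‖ ^ 2 * 2 * β
      = ‖gradient h x - gradient h y‖ ^ 2 := by
    field_simp
  rw [← h3, mul_comm β]
  refine mul_le_mul_of_nonneg_right ?_ hβ.le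
  linarith
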